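/- Let X and A be finite sets and p be an NS correlation over (X,X,A,A). (i) If p is quantum tracial then p belongs to C_q. (ii) p is locally tracial if and only if there exist scalars λ_j ≥ 0 with ∑_{j=1}^k λ_j = 1 and families q_j = {q_j(·|x) : x ∈ X} of probability distributions on A such that p(a,b|x,y) = ∑_{j=1}^k λ_j q_j(a|x) q_j(b|y) for all x,y ∈ X and a,b ∈ A. In particular, every locally tracial NS correlation belongs to C_loc. -/

import Mathlib

open scoped ComplexOrder Kronecker Matrix

noncomputable section

namespace QNS

variable {X Y A B : Type*}

/-- A (classical) no-signalling correlation over `(X, Y, A, B)`. -/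
def IsNS [Fintype X] [Fintype Y] [Fintype A] [Fintype B]
    (p : X → Y → A → B → ℝ) : Prop :=
  (∀ x y a b, 0 ≤ p x y a b) ∧
  (∀ x y, ∑ a : A, ∑ b : B, p x y a b = 1) ∧
  (∀ x x' y b, (∑ a : A, p x y a b) = ∑ a : A, p x' y a b) ∧
  (∀ x y y' a, (∑ b : B, p x y a b) = ∑ b : B, p x y' a b)

/-- A trace on a unital C*-algebra `𝒜` : a unital positive linear functional `τ` with
`τ(uv) = τ(vu)`. -/
def IsTrace {𝒜 : Type*} [Ring 𝒜] [StarRing 𝒜] [Algebra ℂ 𝒜] (τ : 𝒜 →ₗ[ℂ] ℂ) : Prop :=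
  τ 1 = 1 ∧ (∀ a : 𝒜, 0 ≤ τ (star a * a)) ∧ ∀ a b : 𝒜, τ (a * b) = τ (b * a)

/-- Positivity of a square matrix over a C*-algebra `𝒜`, expressed through the standard
characterisation of positive elements of the C*-algebra `M_I(𝒜)` : `g ≥ 0` iff
`g = h^* h` for some `h ∈ M_I(𝒜)`. -/
def PosAMat {I 𝒜 : Type*} [Fintype I] [Ring 𝒜] [StarRing 𝒜] (g : Matrix I I 𝒜) : Prop :=
  ∃ h : Matrix I I 𝒜, g = h.conjTranspose * h

/-- A stochastic `𝒜`-matrix over `(X, A)` : a positive element of `M_{X×A}(𝒜)` with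
`∑ₐ g_{x,x',a,a} = δ_{x,x'} 1`. -/
def IsStochAMat {X A 𝒜 : Type*} [Fintype X] [DecidableEq X] [Fintype A]
    [Ring 𝒜] [StarRing 𝒜] (g : X → X → A → A → 𝒜) : Prop :=
  PosAMat (Matrix.of fun p q : X × A => g p.1 q.1 p.2 q.2) ∧
  ∀ x x' : X, (∑ a : A, g x x' a a) = if x = x' then 1 else 0

variable [Fintype X] [DecidableEq X] [Fintype Y] [DecidableEq Y]
  [Fintype A] [DecidableEq A] [Fintype B] [DecidableEq B]

/-- The class `C_q` of quantum NS correlations: those arising from POVMs on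
finite-dimensional Hilbert spaces and a unit vector of the tensor product. -/
def memCq (p : X → Y → A → B → ℝ) : Prop :=
  IsNS p ∧
  ∃ (m n : ℕ) (E : X → A → Matrix (Fin m) (Fin m) ℂ) (F : Y → B → Matrix (Fin n) (Fin n) ℂ)
    (ξ : Fin m × Fin n → ℂ),
    (∀ x a, (E x a).PosSemidef) ∧ (∀ x, ∑ a : A, E x a = 1) ∧
    (∀ y b, (F y b).PosSemidef) ∧ (∀ y, ∑ b : B, F y b = 1) ∧
    star ξ ⬝ᵥ ξ = 1 ∧
    ∀ x y a b, (p x y a b : ℂ) = star ξ ⬝ᵥ ((E x a ⊗ₖ F y b) *ᵥ ξ)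

/-- The class `C_loc` of local NS correlations. -/
def memCloc (p : X → Y → A → B → ℝ) : Prop :=
  IsNS p ∧
  ∃ (k : ℕ) (lam : Fin k → ℝ) (q1 : Fin k → X → A → ℝ) (q2 : Fin k → Y → B → ℝ),
    (∀ i, 0 ≤ lam i) ∧ (∑ i, lam i = 1) ∧
    (∀ i x a, 0 ≤ q1 i x a) ∧ (∀ i x, ∑ a : A, q1 i x a = 1) ∧
    (∀ i y b, 0 ≤ q2 i y b) ∧ (∀ i y, ∑ b : B, q2 i y b = 1) ∧
    ∀ x y a b, p x y a b = ∑ i, lam i * q1 i x a * q2 i y b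

/-- A quantum tracial NS correlation over `(X, X, A, A)` : one of the form
`p(a,b|x,y) = τ(g_{x,a} g_{y,b})` for a trace `τ` on a finite-dimensional unital
C*-algebra `𝒜` and positive elements `g_{x,a} ∈ 𝒜` with `∑ₐ g_{x,a} = 1`. -/
def IsQuantumTracialNS {X A : Type*} [Fintype X] [Fintype A]
    (p : X → X → A → A → ℝ) : Prop :=
  IsNS p ∧
  ∃ (𝒜 : Type) (_ : NormedRing 𝒜) (_ : StarRing 𝒜) (_ : CStarRing 𝒜)
    (_ : NormedAlgebra ℂ 𝒜) (_ : StarModule ℂ 𝒜) (_ : CompleteSpace 𝒜)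
    (τ : 𝒜 →ₗ[ℂ] ℂ) (g : X → A → 𝒜),
    FiniteDimensional ℂ 𝒜 ∧ IsTrace τ ∧
    (∀ x a, ∃ h : 𝒜, g x a = star h * h) ∧ (∀ x, (∑ a : A, g x a) = 1) ∧
    ∀ x y a b, (p x y a b : ℂ) = τ (g x a * g y b)

/-- A locally tracial NS correlation: the C*-algebra can be chosen commutative. -/
def IsLocallyTracialNS {X A : Type*} [Fintype X] [Fintype A]
    (p : X → X → A → A → ℝ) : Prop :=
  IsNS p ∧
  ∃ (𝒜 : Type) (_ : NormedRing 𝒜) (_ : StarRing 𝒜) (_ : CStarRing 𝒜)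
    (_ : NormedAlgebra ℂ 𝒜) (_ : StarModule ℂ 𝒜) (_ : CompleteSpace 𝒜)
    (τ : 𝒜 →ₗ[ℂ] ℂ) (g : X → A → 𝒜),
    (∀ a b : 𝒜, a * b = b * a) ∧ IsTrace τ ∧
    (∀ x a, ∃ h : 𝒜, g x a = star h * h) ∧ (∀ x, (∑ a : A, g x a) = 1) ∧
    ∀ x y a b, (p x y a b : ℂ) = τ (g x a * g y b)

section FiniteDimensionalTrace

/-- The trace of the left regular representation. -/
def regTrace (𝒜 : Type*) [Ring 𝒜] [Algebra ℂ 𝒜] : 𝒜 →ₗ[ℂ] ℂ :=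
  LinearMap.trace ℂ 𝒜 ∘ₗ (Algebra.lmul ℂ 𝒜).toLinearMap

theorem regTrace_apply {𝒜 : Type*} [Ring 𝒜] [Algebra ℂ 𝒜] (a : 𝒜) :
    regTrace 𝒜 a = LinearMap.trace ℂ 𝒜 (Algebra.lmul ℂ 𝒜 a) := rfl

theorem regTrace_mul_comm {𝒜 : Type*} [Ring 𝒜] [Algebra ℂ 𝒜] (a b : 𝒜) :
    regTrace 𝒜 (a * b) = regTrace 𝒜 (b * a) := by
  simp only [regTrace_apply, map_mul, LinearMap.trace_mul_comm ℂ (Algebra.lmul ℂ 𝒜 a)]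

theorem spectrum_lmul {𝒜 : Type*} [Ring 𝒜] [Algebra ℂ 𝒜] (a : 𝒜) :
    spectrum ℂ (Algebra.lmul ℂ 𝒜 a) = spectrum ℂ a := by
  ext z
  rw [spectrum.mem_iff, spectrum.mem_iff, ← (Algebra.lmul ℂ 𝒜).commutes, ← map_sub,
    Algebra.lmul_isUnit_iff]

variable {𝒜 : Type*} [CStarAlgebra 𝒜]

theorem nonneg_of_mem_spectrum_star_mul_self (a : 𝒜) {z : ℂ}
    (hz : z ∈ spectrum ℂ (star a * a)) : 0 ≤ z := by
  have hre := (IsSelfAdjoint.star_mul_self a).mem_spectrum_eq_re hz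
  rw [hre] at hz ⊢
  exact_mod_cast spectrum_star_mul_self_nonneg _ ((spectrum.algebraMap_mem_iff ℂ).1 hz)

/-- A linear functional that is nonnegative on all `star a * a` is hermitian. -/
theorem map_star_of_nonneg (τ : 𝒜 →ₗ[ℂ] ℂ) (hτ : ∀ a, 0 ≤ τ (star a * a)) (a : 𝒜) :
    τ (star a) = star (τ a) := by
  have him (b : 𝒜) : (τ (star b * b)).im = 0 := (Complex.nonneg_iff.1 (hτ b)).2.symm
  have h0 := him a
  have h1 := him 1
  have h2 := him (1 + a)
  have h3 := him (1 + Complex.I • a)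
  simp only [star_add, star_smul, star_one, mul_add, add_mul, mul_one, one_mul, map_add,
    smul_mul_assoc, mul_smul_comm, map_smul, smul_eq_mul, Complex.add_im, Complex.mul_im,
    Complex.star_def, Complex.conj_I, Complex.neg_re, Complex.neg_im, Complex.I_re,
    Complex.I_im, Complex.mul_re] at h0 h1 h2 h3
  apply Complex.ext
  · simp only [Complex.star_def, Complex.conj_re]
    linarith
  · simp only [Complex.star_def, Complex.conj_im]
    linarith

variable [FiniteDimensional ℂ 𝒜]

theorem mem_roots_charpoly_lmul_iff (a : 𝒜) (z : ℂ) :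
    z ∈ (LinearMap.charpoly (Algebra.lmul ℂ 𝒜 a)).roots ↔ z ∈ spectrum ℂ a := by
  rw [Polynomial.mem_roots (LinearMap.charpoly_monic _).ne_zero,
    ← Module.End.hasEigenvalue_iff_isRoot_charpoly, Module.End.hasEigenvalue_iff_mem_spectrum,
    spectrum_lmul]

theorem regTrace_eq_sum_roots (a : 𝒜) :
    regTrace 𝒜 a = (LinearMap.charpoly (Algebra.lmul ℂ 𝒜 a)).roots.sum :=
  Module.End.trace_eq_sum_roots_charpoly_of_splits (IsAlgClosed.splits _)

theorem regTrace_star_mul_self_nonneg (a : 𝒜) : 0 ≤ regTrace 𝒜 (star a * a) := by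
  rw [regTrace_eq_sum_roots]
  exact Multiset.sum_nonneg fun z hz =>
    nonneg_of_mem_spectrum_star_mul_self a ((mem_roots_charpoly_lmul_iff _ z).1 hz)

theorem eq_zero_of_regTrace_star_mul_self_eq_zero (a : 𝒜)
    (h : regTrace 𝒜 (star a * a) = 0) : a = 0 := by
  rw [regTrace_eq_sum_roots] at h
  have hz := Multiset.all_zero_of_le_zero_le_of_sum_eq_zero (fun z hz =>
    nonneg_of_mem_spectrum_star_mul_self a ((mem_roots_charpoly_lmul_iff _ z).1 hz)) h
  rw [← CStarRing.star_mul_self_eq_zero_iff]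
  exact CFC.eq_zero_of_spectrum_subset_zero (R := ℂ) _
    (fun z hz' => hz z ((mem_roots_charpoly_lmul_iff _ z).2 hz'))
    (IsSelfAdjoint.star_mul_self a).isStarNormal

/-- The regular trace makes a finite-dimensional C*-algebra a Hilbert space. -/
@[reducible] def regCore (𝒜 : Type*) [CStarAlgebra 𝒜] [FiniteDimensional ℂ 𝒜] :
    InnerProductSpace.Core ℂ 𝒜 where
  inner a b := regTrace 𝒜 (star a * b)
  conj_inner_symm a b := by
    rw [starRingEnd_apply, ← map_star_of_nonneg _ regTrace_star_mul_self_nonneg, star_mul,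
      star_star]
  re_inner_nonneg a := (Complex.nonneg_iff.1 (regTrace_star_mul_self_nonneg a)).1
  add_left a b c := by simp [add_mul]
  smul_left a b r := by simp
  definite := eq_zero_of_regTrace_star_mul_self_eq_zero

theorem exists_orthonormal_basis_of_core {V : Type*} [AddCommGroup V] [Module ℂ V]
    [FiniteDimensional ℂ V] (core : InnerProductSpace.Core ℂ V) :
    ∃ (n : ℕ) (b : Module.Basis (Fin n) ℂ V),
      ∀ v i, b.repr v i = core.inner (b i) v := by
  let := core.toNormedAddCommGroup
  let := InnerProductSpace.ofCore core.toCore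
  let b := stdOrthonormalBasis ℂ V
  refine ⟨_, b.toBasis, fun v i => ?_⟩
  rw [b.coe_toBasis_repr_apply, b.repr_apply_apply, b.coe_toBasis]

theorem exists_regTrace_orthonormal_basis (𝒜 : Type*) [CStarAlgebra 𝒜]
    [FiniteDimensional ℂ 𝒜] :
    ∃ (n : ℕ) (b : Module.Basis (Fin n) ℂ 𝒜),
      ∀ v i, b.repr v i = regTrace 𝒜 (star (b i) * v) :=
  exists_orthonormal_basis_of_core (regCore 𝒜)

/-- A trace on a finite-dimensional C*-algebra is given by a central density with respect to
the regular trace. -/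
theorem exists_central_density {τ : 𝒜 →ₗ[ℂ] ℂ} (hτ : IsTrace τ) :
    ∃ ρ : 𝒜, (∀ a, τ a = regTrace 𝒜 (ρ * a)) ∧ ∀ a, Commute ρ a := by
  obtain ⟨n, b, hb⟩ := exists_regTrace_orthonormal_basis 𝒜
  have hρ (a : 𝒜) : τ a = regTrace 𝒜 ((∑ i, τ (b i) • star (b i)) * a) := by
    conv_lhs => rw [← b.sum_repr a]
    simp only [map_sum, map_smul, Finset.sum_mul, smul_mul_assoc, hb, smul_eq_mul]
    exact Finset.sum_congr rfl fun i _ => mul_comm _ _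
  refine ⟨_, hρ, fun a => sub_eq_zero.1 ?_⟩
  set ρ := ∑ i, τ (b i) • star (b i)
  have key (c : 𝒜) : regTrace 𝒜 (c * (ρ * a - a * ρ)) = 0 := by
    rw [mul_sub, map_sub, sub_eq_zero, regTrace_mul_comm c, mul_assoc, ← hρ, ← mul_assoc,
      regTrace_mul_comm _ ρ, ← hρ, hτ.2.2]
  exact eq_zero_of_regTrace_star_mul_self_eq_zero _ (key _)

open scoped MatrixOrder Matrix.Norms.L2Operator in
theorem exists_commuting_sqrt {n : ℕ} {P : Matrix (Fin n) (Fin n) ℂ} (hP : P.PosSemidef) :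
    ∃ K : Matrix (Fin n) (Fin n) ℂ, Kᴴ = K ∧ K * K = P ∧ ∀ M, Commute P M → Commute K M := by
  have hP' : 0 ≤ P := Matrix.nonneg_iff_posSemidef.2 hP
  refine ⟨CFC.sqrt P, ?_, CFC.sqrt_mul_sqrt_self P hP', fun M hM => ?_⟩
  · exact (Matrix.nonneg_iff_posSemidef.1 (CFC.sqrt_nonneg P)).isHermitian
  · exact hM.cfcₙ_nnreal _

/-- A trace on a finite-dimensional C*-algebra is represented by a vector in a tensor product,
with the left factor a *-representation and the right factor its transpose. -/
theorem exists_vector_representation {τ : 𝒜 →ₗ[ℂ] ℂ} (hτ : IsTrace τ) :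
    ∃ (n : ℕ) (M : 𝒜 →ₐ[ℂ] Matrix (Fin n) (Fin n) ℂ) (ξ : Fin n × Fin n → ℂ),
      (∀ a, M (star a) = (M a)ᴴ) ∧
      ∀ a b, star ξ ⬝ᵥ (((M a)ᵀ ⊗ₖ M b) *ᵥ ξ) = τ (a * b) := by
  obtain ⟨n, b, hb⟩ := exists_regTrace_orthonormal_basis 𝒜
  obtain ⟨ρ, hρ, hcomm⟩ := exists_central_density hτ
  have hM (a : 𝒜) (i j) :
      Algebra.leftMulMatrix b a i j = regTrace 𝒜 (star (b i) * (a * b j)) := by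
    rw [Algebra.leftMulMatrix_eq_repr_mul, hb]
  have hstar (a : 𝒜) : Algebra.leftMulMatrix b (star a) = (Algebra.leftMulMatrix b a)ᴴ := by
    ext i j
    rw [Matrix.conjTranspose_apply, hM, hM,
      ← map_star_of_nonneg _ regTrace_star_mul_self_nonneg]
    simp only [star_mul, star_star, mul_assoc]
  have hP (i j) : Algebra.leftMulMatrix b ρ i j = τ (star (b i) * b j) := by
    rw [hM, hρ, ← mul_assoc, ← mul_assoc, (hcomm _).eq]
  have hpos : (Algebra.leftMulMatrix b ρ).PosSemidef := by
    refine .of_dotProduct_mulVec_nonneg ?_ fun x => ?_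
    · ext i j
      rw [Matrix.conjTranspose_apply, hP, hP, ← map_star_of_nonneg _ hτ.2.1, star_mul, star_star]
    · have h := hτ.2.1 (∑ i, x i • b i)
      rw [star_sum, Finset.sum_mul_sum] at h
      simpa [dotProduct, Matrix.mulVec, hP, Finset.mul_sum, mul_comm, mul_left_comm] using h
  obtain ⟨K, hKh, hKK, hK⟩ := exists_commuting_sqrt hpos
  refine ⟨n, Algebra.leftMulMatrix b, K.vec, hstar, fun a c => ?_⟩
  have hKa := hK _ ((hcomm c).map (Algebra.leftMulMatrix b))
  rw [Matrix.kronecker_mulVec_vec, Matrix.star_vec_dotProduct_vec, Matrix.transpose_transpose,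
    hKh, ← hKa.eq, ← mul_assoc, ← mul_assoc, hKK, ← map_mul, ← map_mul, mul_assoc, hτ.2.2, hρ,
    regTrace_apply, LinearMap.trace_eq_matrix_trace ℂ b, Algebra.leftMulMatrix_apply]

theorem quantum_of_trace {X A : Type*} [Fintype X] [Fintype A] {p : X → X → A → A → ℝ}
    (hp : IsNS p) {τ : 𝒜 →ₗ[ℂ] ℂ} (hτ : IsTrace τ) {g : X → A → 𝒜}
    (hg : ∀ x a, ∃ h : 𝒜, g x a = star h * h) (hsum : ∀ x, ∑ a, g x a = 1)
    (hpg : ∀ x y a b, (p x y a b : ℂ) = τ (g x a * g y b)) : memCq p := by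
  obtain ⟨n, M, ξ, hstar, hξ⟩ := exists_vector_representation hτ
  have hpos (x a) : (M (g x a)).PosSemidef := by
    obtain ⟨h, hh⟩ := hg x a
    rw [hh, map_mul, hstar]
    exact Matrix.posSemidef_conjTranspose_mul_self _
  have hone (x) : ∑ a, M (g x a) = 1 := by rw [← map_sum, hsum, map_one]
  refine ⟨hp, n, n, fun x a => (M (g x a))ᵀ, fun x a => M (g x a), ξ,
    fun x a => (hpos x a).transpose, fun x => ?_, hpos, hone, ?_, fun x y a b => ?_⟩
  · rw [← Matrix.transpose_sum, hone, Matrix.transpose_one]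
  · simpa [hτ.1] using hξ 1 1
  · rw [hpg, hξ]

end FiniteDimensionalTrace

section CommutativeTrace

/-- In finite dimension the convex hull of a compact set is compact. -/
theorem isCompact_convexHull_of_finiteDimensional {E : Type*} [AddCommGroup E] [Module ℝ E]
    [TopologicalSpace E] [IsTopologicalAddGroup E] [ContinuousSMul ℝ E] [FiniteDimensional ℝ E]
    {s : Set E} (hs : IsCompact s) : IsCompact (convexHull ℝ s) := by
  let comb (k : ℕ) (w : (Fin k → ℝ) × (Fin k → E)) : E := ∑ i, w.1 i • w.2 i
  have hcomb (k : ℕ) : Continuous (comb k) := by fun_prop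
  have heq : convexHull ℝ s = ⋃ k ∈ Finset.range (Module.finrank ℝ E + 2),
      comb k '' (stdSimplex ℝ (Fin k) ×ˢ Set.univ.pi fun _ => s) := by
    ext v
    simp only [Set.mem_iUnion, Set.mem_image, exists_prop]
    constructor
    · intro hv
      obtain ⟨ι, _, z, w, hz, hind, hw, hw1, hwz⟩ := eq_pos_convex_span_of_mem_convexHull hv
      have hcard := hind.card_le_finrank_succ
      have hle := Submodule.finrank_le (vectorSpan ℝ (Set.range z))
      let e := Fintype.equivFin ι
      refine ⟨Fintype.card ι, by simp only [Finset.mem_range]; omega,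
        (w ∘ e.symm, z ∘ e.symm), ⟨⟨fun i => (hw _).le, ?_⟩, fun i _ => hz ⟨_, rfl⟩⟩, ?_⟩
      · rw [← hw1]
        exact e.symm.sum_comp w
      · rw [← hwz]
        exact e.symm.sum_comp fun i => w i • z i
    · rintro ⟨k, -, ⟨w, z⟩, ⟨⟨hw, hw1⟩, hz⟩, rfl⟩
      exact mem_convexHull_of_exists_fintype w z hw hw1 (fun i => hz i trivial) rfl
  rw [heq]
  exact Finset.isCompact_biUnion _ fun k _ =>
    ((isCompact_stdSimplex ℝ (Fin k)).prod (isCompact_univ_pi fun _ => hs)).image (hcomb k)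

/-- The correlation in which both parties sample independently from `q`. -/
def prodCorr {X A : Type*} (q : X → A → ℝ) (i : X × X × A × A) : ℝ :=
  q i.1 i.2.2.1 * q i.2.1 i.2.2.2

/-- The product correlations of families of probability distributions. -/
def prodCorrSet (X A : Type*) [Fintype A] : Set (X × X × A × A → ℝ) :=
  prodCorr '' Set.univ.pi fun _ : X => stdSimplex ℝ A

theorem isCompact_prodCorrSet (X A : Type*) [Fintype A] : IsCompact (prodCorrSet X A) := by
  refine (isCompact_univ_pi fun _ => isCompact_stdSimplex ℝ A).image ?_
  unfold prodCorr
  fun_prop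

open WeakDual in
/-- An element of a commutative C*-algebra on which all characters are nonnegative is of the
form `star h * h`. -/
theorem exists_eq_star_mul_self_of_character_nonneg {𝒜 : Type*} [CommCStarAlgebra 𝒜] (c : 𝒜)
    (hc : ∀ χ : characterSpace ℂ 𝒜, 0 ≤ χ c) : ∃ h : 𝒜, c = star h * h := by
  let f : C(characterSpace ℂ 𝒜, ℂ) :=
    ⟨fun χ => (Real.sqrt (gelfandStarTransform 𝒜 c χ).re : ℂ), by fun_prop⟩
  refine ⟨(gelfandStarTransform 𝒜).symm f, EquivLike.injective (gelfandStarTransform 𝒜) ?_⟩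
  rw [map_mul, map_star, StarAlgEquiv.apply_symm_apply]
  ext χ
  have hχ : 0 ≤ gelfandStarTransform 𝒜 c χ := hc χ
  rw [Complex.nonneg_iff] at hχ
  simp only [f, ContinuousMap.mul_apply, ContinuousMap.star_apply, ContinuousMap.coe_mk,
    Complex.star_def, Complex.conj_ofReal]
  rw [← Complex.ofReal_mul, Real.mul_self_sqrt hχ.1]
  exact Complex.ext rfl (by simpa using hχ.2.symm)

open WeakDual in
theorem mem_convexHull_prodCorrSet_of_trace {X A 𝒜 : Type*} [Fintype X] [Fintype A]
    [CommCStarAlgebra 𝒜] {p : X → X → A → A → ℝ} {τ : 𝒜 →ₗ[ℂ] ℂ} (hτ : IsTrace τ)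
    {g : X → A → 𝒜} (hg : ∀ x a, ∃ h : 𝒜, g x a = star h * h) (hsum : ∀ x, ∑ a, g x a = 1)
    (hpg : ∀ x y a b, (p x y a b : ℂ) = τ (g x a * g y b)) :
    (fun i : X × X × A × A => p i.1 i.2.1 i.2.2.1 i.2.2.2) ∈ convexHull ℝ (prodCorrSet X A) := by
  classical
  by_contra hnot
  obtain ⟨f, u, hfu, huf⟩ := geometric_hahn_banach_closed_point (convex_convexHull ℝ _)
    (isCompact_convexHull_of_finiteDimensional (isCompact_prodCorrSet X A)).isClosed hnot
  let d (i : X × X × A × A) : ℝ := f fun j => if i = j then 1 else 0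
  have hf (v : X × X × A × A → ℝ) : f v = ∑ i, v i * d i :=
    LinearMap.pi_apply_eq_sum_univ f.toLinearMap v
  let c : 𝒜 := (u : ℂ) • 1 - ∑ i, (d i : ℂ) • (g i.1 i.2.2.1 * g i.2.1 i.2.2.2)
  have hc (χ : characterSpace ℂ 𝒜) : 0 ≤ χ c := by
    have hnn (x a) : 0 ≤ χ (g x a) := by
      obtain ⟨h, hh⟩ := hg x a
      rw [hh, map_mul, map_star]
      exact star_mul_self_nonneg _
    have hre (x a) : χ (g x a) = ((χ (g x a)).re : ℂ) :=
      Complex.ext rfl (by simpa using (Complex.nonneg_iff.1 (hnn x a)).2.symm)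
    let q (x : X) (a : A) : ℝ := (χ (g x a)).re
    have hq : prodCorr q ∈ prodCorrSet X A := by
      refine ⟨q, fun x _ => ⟨fun a => (Complex.nonneg_iff.1 (hnn x a)).1, ?_⟩, rfl⟩
      have h1 := congrArg (fun z => (χ z).re) (hsum x)
      simpa [q] using h1
    have hlt := hfu _ (subset_convexHull ℝ _ hq)
    have heq : χ c = ((u - ∑ i, prodCorr q i * d i : ℝ) : ℂ) := by
      simp only [c, map_sub, map_smul, map_one, map_sum, map_mul, prodCorr, q, smul_eq_mul, mul_one]
      push_cast
      simp only [← hre]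
      exact congrArg _ (Finset.sum_congr rfl fun i _ => mul_comm _ _)
    rw [heq, ← hf]
    exact_mod_cast (sub_pos.2 hlt).le
  obtain ⟨h, hh⟩ := exists_eq_star_mul_self_of_character_nonneg c hc
  have hτc := hτ.2.1 h
  have heq : τ c = ((u - ∑ i, p i.1 i.2.1 i.2.2.1 i.2.2.2 * d i : ℝ) : ℂ) := by
    simp only [c, map_sub, map_smul, map_sum, hτ.1, smul_eq_mul, mul_one]
    push_cast
    simp only [hpg]
    exact congrArg _ (Finset.sum_congr rfl fun i _ => mul_comm _ _)
  rw [← hh, heq, ← hf (fun i => p i.1 i.2.1 i.2.2.1 i.2.2.2)] at hτc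
  have : 0 ≤ u - f fun i => p i.1 i.2.1 i.2.2.1 i.2.2.2 := by exact_mod_cast hτc
  linarith

theorem exists_symmetric_decomposition {X A : Type*} [Fintype A] {p : X → X → A → A → ℝ}
    (h : (fun i : X × X × A × A => p i.1 i.2.1 i.2.2.1 i.2.2.2) ∈
      convexHull ℝ (prodCorrSet X A)) :
    ∃ (k : ℕ) (lam : Fin k → ℝ) (q : Fin k → X → A → ℝ),
      (∀ j, 0 ≤ lam j) ∧ (∑ j, lam j = 1) ∧
      (∀ j x a, 0 ≤ q j x a) ∧ (∀ j x, ∑ a : A, q j x a = 1) ∧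
      ∀ x y a b, p x y a b = ∑ j, lam j * q j x a * q j y b := by
  obtain ⟨ι, _, w, z, hw, hw1, hz, hwz⟩ := mem_convexHull_iff_exists_fintype.1 h
  choose q hq hqz using hz
  let e := Fintype.equivFin ι
  refine ⟨Fintype.card ι, w ∘ e.symm, q ∘ e.symm, fun j => hw _, ?_,
    fun j x a => (hq (e.symm j) x trivial).1 a, fun j x => (hq (e.symm j) x trivial).2,
    fun x y a b => ?_⟩
  · rw [← hw1]
    exact e.symm.sum_comp w
  · have h1 := congrFun hwz (x, y, a, b)
    simp only [Finset.sum_apply, Pi.smul_apply, ← hqz, prodCorr, smul_eq_mul] at h1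
    rw [← h1, ← e.symm.sum_comp]
    simp only [Function.comp_apply, mul_assoc]

theorem isLocallyTracialNS_of_decomposition {X A : Type*} [Fintype X] [Fintype A]
    {p : X → X → A → A → ℝ} (hp : IsNS p) {k : ℕ} {lam : Fin k → ℝ} {q : Fin k → X → A → ℝ}
    (hlam : ∀ j, 0 ≤ lam j) (hlam1 : ∑ j, lam j = 1) (hq : ∀ j x a, 0 ≤ q j x a)
    (hq1 : ∀ j x, ∑ a : A, q j x a = 1)
    (hpq : ∀ x y a b, p x y a b = ∑ j, lam j * q j x a * q j y b) : IsLocallyTracialNS p := by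
  refine ⟨hp, Fin k → ℂ, inferInstance, inferInstance, inferInstance, inferInstance,
    inferInstance, inferInstance, ∑ j, (lam j : ℂ) • LinearMap.proj j,
    fun x a j => (q j x a : ℂ), mul_comm, ⟨?_, fun a => ?_, fun a b => by rw [mul_comm]⟩,
    fun x a => ⟨fun j => (Real.sqrt (q j x a) : ℂ), ?_⟩, fun x => ?_, fun x y a b => ?_⟩
  · simpa using congrArg (fun r : ℝ => (r : ℂ)) hlam1
  · simp only [LinearMap.sum_apply, LinearMap.smul_apply, LinearMap.proj_apply, Pi.mul_apply,
      Pi.star_apply, smul_eq_mul]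
    exact Finset.sum_nonneg fun j _ =>
      mul_nonneg (by exact_mod_cast hlam j) (star_mul_self_nonneg _)
  · ext j
    simp only [Pi.mul_apply, Pi.star_apply, Complex.star_def, Complex.conj_ofReal]
    rw [← Complex.ofReal_mul, Real.mul_self_sqrt (hq j x a)]
  · ext j
    rw [Finset.sum_apply, Pi.one_apply]
    simpa using congrArg (fun r : ℝ => (r : ℂ)) (hq1 j x)
  · rw [hpq]
    simp [mul_assoc]

theorem IsLocallyTracialNS.exists_decomposition {X A : Type*} [Fintype X] [Fintype A]
    {p : X → X → A → A → ℝ} (h : IsLocallyTracialNS p) :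
    ∃ (k : ℕ) (lam : Fin k → ℝ) (q : Fin k → X → A → ℝ),
      (∀ j, 0 ≤ lam j) ∧ (∑ j, lam j = 1) ∧
      (∀ j x a, 0 ≤ q j x a) ∧ (∀ j x, ∑ a : A, q j x a = 1) ∧
      ∀ x y a b, p x y a b = ∑ j, lam j * q j x a * q j y b := by
  obtain ⟨-, 𝒜, _, _, _, _, _, _, τ, g, hcomm, hτ, hg, hsum, hpg⟩ := h
  let : CommCStarAlgebra 𝒜 := { mul_comm := hcomm }
  exact exists_symmetric_decomposition (mem_convexHull_prodCorrSet_of_trace hτ hg hsum hpg)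

end CommutativeTrace

/-- Proposition 8.20 of the paper.  Let `p` be an NS correlation over
`(X, X, A, A)`.  (i) If `p` is quantum tracial then `p ∈ C_q`.  (ii) `p` is locally
tracial iff `p(a,b|x,y) = ∑ⱼ λⱼ qⱼ(a|x) qⱼ(b|y)` for families of probability
distributions `qⱼ` and convex weights `λⱼ`.  In particular, every locally tracial NS
correlation belongs to `C_loc`. -/
theorem ns_tracial (p : X → X → A → A → ℝ) (hp : IsNS p) :
    (IsQuantumTracialNS p → memCq p) ∧
    (IsLocallyTracialNS p ↔
      ∃ (k : ℕ) (lam : Fin k → ℝ) (q : Fin k → X → A → ℝ),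
        (∀ j, 0 ≤ lam j) ∧ (∑ j, lam j = 1) ∧
        (∀ j x a, 0 ≤ q j x a) ∧ (∀ j x, ∑ a : A, q j x a = 1) ∧
        ∀ x y a b, p x y a b = ∑ j, lam j * q j x a * q j y b) ∧
    (IsLocallyTracialNS p → memCloc p) := by
  refine ⟨?_, ⟨IsLocallyTracialNS.exists_decomposition, ?_⟩, fun h => ?_⟩
  · rintro ⟨-, 𝒜, _, _, _, _, _, _, τ, g, _, hτ, hg, hsum, hpg⟩
    let : CStarAlgebra 𝒜 := {}
    exact quantum_of_trace hp hτ hg hsum hpg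
  · rintro ⟨k, lam, q, hlam, hlam1, hq, hq1, hpq⟩
    exact isLocallyTracialNS_of_decomposition hp hlam hlam1 hq hq1 hpq
  · obtain ⟨k, lam, q, hlam, hlam1, hq, hq1, hpq⟩ := h.exists_decomposition
    exact ⟨hp, k, lam, q, q, hlam, hlam1, hq, hq1, hq, hq1, hpq⟩

end QNS
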